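/- Let X be a geodesic metric space and suppose for every pair of points x, y a path ρ_{x,y} connecting x to y has been chosen, such that: (1) if d(x,y) ≤ 1 then ρ_{x,y} has image of diameter at most n; (2) for all x, y and parameters s < t, the Hausdorff distance between the subpath ρ_{x,y}[s,t] and ρ_{ρ_{x,y}(s),ρ_{x,y}(t)} is at most n; (3) for any x, y, z, the image of ρ_{x,y} lies in the n-neighborhood of the union of the images of ρ_{y,z} and ρ_{z,x}. Then X is Gromov hyperbolic. -/

import Mathlib

open Metric

/-- A metric space is geodesic if any two points are joined by an isometrically
parametrized path. -/
def GeodesicSpace (X : Type*) [MetricSpace X] : Prop :=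
  ∀ x y : X, ∃ f : ℝ → X, f 0 = x ∧ f (dist x y) = y ∧
    ∀ s t : ℝ, s ∈ Set.Icc (0 : ℝ) (dist x y) → t ∈ Set.Icc (0 : ℝ) (dist x y) →
      dist (f s) (f t) = |s - t|

/-- Gromov hyperbolicity (four-point condition) of a metric space. -/
def GromovHyperbolic (X : Type*) [MetricSpace X] : Prop :=
  ∃ δ : ℝ, 0 ≤ δ ∧ ∀ x y z w : X,
    dist x y + dist z w ≤ max (dist x z + dist y w) (dist x w + dist y z) + 2 * δ

open Set in
theorem hc_clip (s r R : ℝ) (hR : 0 ≤ R) : ∃ s' ∈ uIcc s r, |s' - r| ≤ 3 * R ∧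
    (s' = s ∨ ∀ r' ∈ uIcc s' s, 3 * R ≤ |r - r'|) := by
  by_cases h : |s - r| ≤ 3 * R
  · exact ⟨s, left_mem_uIcc, h, Or.inl rfl⟩
  push Not at h
  rcases le_total s r with hsr | hsr
  · rw [abs_of_nonpos (by linarith)] at h
    refine ⟨r - 3 * R, ?_, ?_, Or.inr ?_⟩
    · rw [uIcc_of_le hsr]; constructor <;> linarith
    · rw [abs_of_nonpos (by linarith)]; linarith
    · intro r' hr'
      rw [uIcc_of_ge (by linarith)] at hr'
      have := le_abs_self (r - r')
      linarith [hr'.2]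
  · rw [abs_of_nonneg (by linarith)] at h
    refine ⟨r + 3 * R, ?_, ?_, Or.inr ?_⟩
    · rw [uIcc_of_ge hsr]; constructor <;> linarith
    · rw [abs_of_nonneg (by linarith)]; linarith
    · intro r' hr'
      rw [uIcc_of_le (by linarith)] at hr'
      have := neg_le_abs (r - r')
      linarith [hr'.1]

theorem hc_growth (n : ℝ) : ∃ R₀ : ℝ, 1 ≤ R₀ ∧ ∀ R, R₀ ≤ R → ∃ k : ℕ,
    6 * R ≤ 2 ^ k ∧ (k + 3) * n + 1 ≤ R := by
  have hlim : Filter.Tendsto (fun k : ℕ => ((k : ℝ) ^ 1) / (2:ℝ) ^ k) Filter.atTop (nhds 0) :=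
    tendsto_pow_const_div_const_pow_of_one_lt 1 (by norm_num)
  have hlim0 : Filter.Tendsto (fun k : ℕ => ((k : ℝ) ^ 0) / (2:ℝ) ^ k) Filter.atTop (nhds 0) :=
    tendsto_pow_const_div_const_pow_of_one_lt 0 (by norm_num)
  have hl : Filter.Tendsto (fun k : ℕ => n * (((k : ℝ) ^ 1) / (2:ℝ) ^ k)
      + (4 * n + 1) * (((k : ℝ) ^ 0) / (2:ℝ) ^ k)) Filter.atTop (nhds 0) := by
    simpa using (hlim.const_mul n).add (hlim0.const_mul (4 * n + 1))
  have hev := hl.eventually (gt_mem_nhds (show (0:ℝ) < 1 / 6 by norm_num))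
  obtain ⟨K, hK⟩ := Filter.eventually_atTop.1 hev
  refine ⟨2 ^ K, one_le_pow₀ (by norm_num), fun R hR => ?_⟩
  have h1K : (1:ℝ) ≤ 2 ^ K := one_le_pow₀ (by norm_num)
  obtain ⟨m, hm1, hm2⟩ := exists_nat_pow_near (show (1:ℝ) ≤ 6 * R by linarith)
    (show (1:ℝ) < 2 by norm_num)
  refine ⟨m + 1, hm2.le, ?_⟩
  have hKm : K ≤ m := by
    have : (2:ℝ) ^ K < 2 ^ (m + 1) := by linarith
    have := (pow_lt_pow_iff_right₀ (show (1:ℝ) < 2 by norm_num)).1 this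
    omega
  have h := hK m hKm
  have hp : (0:ℝ) < 2 ^ m := by positivity
  have h' : (n * m + (4 * n + 1)) / 2 ^ m < 1 / 6 := by
    have e : n * (((m : ℝ) ^ 1) / (2:ℝ) ^ m) + (4 * n + 1) * (((m : ℝ) ^ 0) / (2:ℝ) ^ m)
      = (n * m + (4 * n + 1)) / 2 ^ m := by
      rw [pow_one, pow_zero]; ring
    rw [← e]; exact h
  rw [div_lt_iff₀ hp] at h'
  push_cast
  linarith

open Set in
theorem hc_log {X : Type*} [MetricSpace X] (ρ : X → X → ℝ → X) (n : ℝ)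
    (hstart : ∀ x y, ρ x y 0 = x)
    (h1 : ∀ x y, dist x y ≤ 1 → ∀ u ∈ Icc (0:ℝ) 1, dist (ρ x y u) x ≤ n)
    (h3 : ∀ x y z, ∀ u ∈ Set.Icc (0:ℝ) 1, ∃ w ∈ Set.Icc (0:ℝ) 1,
      dist (ρ x y u) (ρ y z w) ≤ n ∨ dist (ρ x y u) (ρ z x w) ≤ n)
    (D : ℝ) (f : ℝ → X)
    (hf : ∀ s t : ℝ, s ∈ Icc (0 : ℝ) D → t ∈ Icc (0 : ℝ) D → dist (f s) (f t) = |s - t|)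
    (k : ℕ) : ∀ s ∈ Icc (0:ℝ) D, ∀ t ∈ Icc (0:ℝ) D, |s - t| ≤ 2 ^ k → ∀ u ∈ Icc (0:ℝ) 1,
      ∃ r ∈ uIcc s t, dist (ρ (f s) (f t) u) (f r) ≤ (k + 1) * n := by
  induction k with
  | zero =>
    intro s hs t ht hst u hu
    refine ⟨s, left_mem_uIcc, ?_⟩
    have := h1 (f s) (f t) (by rw [hf s t hs ht]; simpa using hst) u hu
    simpa using this
  | succ k ih =>
    intro s hs t ht hst u hu
    have hm : (s + t) / 2 ∈ Icc (0:ℝ) D := ⟨by linarith [hs.1, ht.1], by linarith [hs.2, ht.2]⟩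
    have hmu : (s + t) / 2 ∈ uIcc s t := by
      rw [mem_uIcc]
      rcases le_total s t with h | h
      · left; constructor <;> linarith
      · right; constructor <;> linarith
    rw [pow_succ] at hst
    have ha := abs_le.1 hst
    obtain ⟨w, hw, h⟩ := h3 (f s) (f t) (f ((s + t) / 2)) u hu
    push_cast
    rcases h with h | h
    · obtain ⟨r, hr, hd⟩ := ih t ht _ hm (by rw [abs_le]; constructor <;> linarith) w hw
      refine ⟨r, uIcc_subset_uIcc right_mem_uIcc hmu hr, ?_⟩
      have := dist_triangle (ρ (f s) (f t) u) (ρ (f t) (f ((s + t) / 2)) w) (f r)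
      linarith
    · obtain ⟨r, hr, hd⟩ := ih _ hm s hs (by rw [abs_le]; constructor <;> linarith) w hw
      refine ⟨r, uIcc_subset_uIcc hmu left_mem_uIcc hr, ?_⟩
      have := dist_triangle (ρ (f s) (f t) u) (ρ (f ((s + t) / 2)) (f s) w) (f r)
      linarith

open Set in
theorem hc_key {X : Type*} [MetricSpace X] (ρ : X → X → ℝ → X) (n : ℝ) (hn : 0 < n)
    (hstart : ∀ x y, ρ x y 0 = x)
    (h1 : ∀ x y, dist x y ≤ 1 → ∀ u ∈ Icc (0:ℝ) 1, dist (ρ x y u) x ≤ n)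
    (h3 : ∀ x y z, ∀ u ∈ Set.Icc (0:ℝ) 1, ∃ w ∈ Set.Icc (0:ℝ) 1,
      dist (ρ x y u) (ρ y z w) ≤ n ∨ dist (ρ x y u) (ρ z x w) ≤ n)
    (D : ℝ) (f : ℝ → X)
    (hf : ∀ s t : ℝ, s ∈ Icc (0 : ℝ) D → t ∈ Icc (0 : ℝ) D → dist (f s) (f t) = |s - t|)
    (R : ℝ) (k : ℕ) (hk : 6 * R ≤ 2 ^ k) (hkR : (k + 3) * n + 1 ≤ R)
    (hP : ∀ s ∈ Icc (0:ℝ) D, ∀ t ∈ Icc (0:ℝ) D, ∀ u ∈ Icc (0:ℝ) 1,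
      ∃ r ∈ uIcc s t, dist (ρ (f s) (f t) u) (f r) ≤ R) :
    ∀ s ∈ Icc (0:ℝ) D, ∀ t ∈ Icc (0:ℝ) D, ∀ u ∈ Icc (0:ℝ) 1,
      ∃ r ∈ uIcc s t, dist (ρ (f s) (f t) u) (f r) ≤ R - 1 := by
  intro s hs t ht u hu
  have hkn : 0 ≤ (k:ℝ) * n := by positivity
  have hRn : 3 * n + 1 ≤ R := by linarith
  obtain ⟨r, hr, hd⟩ := hP s hs t ht u hu
  have hst : uIcc s t ⊆ Icc 0 D := uIcc_subset_Icc hs ht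
  obtain ⟨s', hs', hs'R, hs'c⟩ := hc_clip s r R (by linarith)
  obtain ⟨t', ht', ht'R, ht'c⟩ := hc_clip t r R (by linarith)
  have hs'' : s' ∈ uIcc s t := uIcc_subset_uIcc left_mem_uIcc hr hs'
  have ht'' : t' ∈ uIcc s t := uIcc_subset_uIcc right_mem_uIcc hr ht'
  set p := ρ (f s) (f t) u with hp
  -- the end pieces
  have hend : ∀ a ∈ Icc (0:ℝ) D, ∀ a' ∈ Icc (0:ℝ) D, a ∈ uIcc s t →
      (a' = a ∨ ∀ r' ∈ uIcc a' a, 3 * R ≤ |r - r'|) →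
      ∀ w ∈ Icc (0:ℝ) 1, dist p (ρ (f a') (f a) w) ≤ 2 * n →
      ∃ r ∈ uIcc s t, dist p (f r) ≤ R - 1 := by
    intro a ha a' ha' hau hc w hw hpw
    rcases hc with rfl | hc
    · refine ⟨a', hau, ?_⟩
      have := h1 (f a') (f a') (by simp) w hw
      have := dist_triangle p (ρ (f a') (f a') w) (f a')
      linarith
    · exfalso
      obtain ⟨r', hr', hd'⟩ := hP a' ha' a ha w hw
      have h := hc r' hr'
      rw [← hf r r' (hst hr) (uIcc_subset_Icc ha' ha hr')] at h
      have e1 := dist_triangle (f r) p (f r')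
      have e2 := dist_triangle p (ρ (f a') (f a) w) (f r')
      rw [dist_comm (f r) p] at e1
      linarith
  obtain ⟨w, hw, h⟩ := h3 (f s) (f t) (f s') u hu
  rcases h with h | h
  · obtain ⟨v, hv, h'⟩ := h3 (f t) (f s') (f t') w hw
    rcases h' with h' | h'
    · obtain ⟨r', hr', hd'⟩ := hc_log ρ n hstart h1 h3 D f hf k s' (hst hs'') t' (hst ht'')
        (by
          rw [abs_le] at *
          constructor <;> linarith) v hv
      refine ⟨r', uIcc_subset_uIcc hs'' ht'' hr', ?_⟩
      have e1 := dist_triangle p (ρ (f t) (f s') w) (f r')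
      have e2 := dist_triangle (ρ (f t) (f s') w) (ρ (f s') (f t') v) (f r')
      linarith
    · refine hend t ht t' (hst ht'') right_mem_uIcc ht'c v hv ?_
      have e1 := dist_triangle p (ρ (f t) (f s') w) (ρ (f t') (f t) v)
      linarith
  · exact hend s hs s' (hst hs'') left_mem_uIcc hs'c w hw (by linarith)

open Set in
theorem hc_unif {X : Type*} [MetricSpace X] (hgeo : GeodesicSpace X)
    (ρ : X → X → ℝ → X) (n : ℝ) (hn : 0 < n)
    (hstart : ∀ x y, ρ x y 0 = x)
    (h1 : ∀ x y, dist x y ≤ 1 → ∀ u ∈ Icc (0:ℝ) 1, dist (ρ x y u) x ≤ n)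
    (h3 : ∀ x y z, ∀ u ∈ Set.Icc (0:ℝ) 1, ∃ w ∈ Set.Icc (0:ℝ) 1,
      dist (ρ x y u) (ρ y z w) ≤ n ∨ dist (ρ x y u) (ρ z x w) ≤ n) :
    ∃ R : ℝ, 0 ≤ R ∧ ∀ x y, ∀ u ∈ Icc (0:ℝ) 1,
      dist x (ρ x y u) + dist (ρ x y u) y ≤ dist x y + 2 * R := by
  obtain ⟨R₀, hR₀, hG⟩ := hc_growth n
  refine ⟨R₀, by linarith, fun x y u hu => ?_⟩
  obtain ⟨f, hf0, hf1, hf⟩ := hgeo x y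
  have hD : 0 ≤ dist x y := dist_nonneg
  have hstep : ∀ m : ℕ, (∀ s ∈ Icc (0:ℝ) (dist x y), ∀ t ∈ Icc (0:ℝ) (dist x y),
      ∀ u ∈ Icc (0:ℝ) 1, ∃ r ∈ uIcc s t, dist (ρ (f s) (f t) u) (f r) ≤ R₀ + m) →
      (∀ s ∈ Icc (0:ℝ) (dist x y), ∀ t ∈ Icc (0:ℝ) (dist x y),
      ∀ u ∈ Icc (0:ℝ) 1, ∃ r ∈ uIcc s t, dist (ρ (f s) (f t) u) (f r) ≤ R₀) := by
    intro m
    induction m with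
    | zero => intro h; simpa using h
    | succ m ih =>
      intro h
      apply ih
      have hm : (0:ℝ) ≤ m := Nat.cast_nonneg m
      obtain ⟨k, hk, hkR⟩ := hG (R₀ + ((m + 1 : ℕ) : ℝ)) (by push_cast; linarith)
      have := hc_key ρ n hn hstart h1 h3 _ f hf _ k hk hkR h
      have e : R₀ + ((m + 1 : ℕ) : ℝ) - 1 = R₀ + m := by push_cast; ring
      rwa [e] at this
  obtain ⟨k, hk⟩ := pow_unbounded_of_one_lt (dist x y) (show (1:ℝ) < 2 by norm_num)
  obtain ⟨m, hm⟩ := exists_nat_ge (((k:ℝ) + 1) * n)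
  have hfin := hstep m (by
    intro s hs t ht v hv
    obtain ⟨r, hr, hd⟩ := hc_log ρ n hstart h1 h3 _ f hf k s hs t ht
      (by rw [abs_le]; constructor <;> linarith [hs.1, hs.2, ht.1, ht.2]) v hv
    exact ⟨r, hr, by linarith⟩)
  obtain ⟨r, hr, hd⟩ := hfin 0 ⟨le_rfl, hD⟩ (dist x y) ⟨hD, le_rfl⟩ u hu
  rw [uIcc_of_le hD] at hr
  have e0 := hf 0 r ⟨le_rfl, hD⟩ hr
  have e1 := hf r (dist x y) hr ⟨hD, le_rfl⟩
  rw [abs_of_nonpos (by linarith [hr.1])] at e0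
  rw [abs_of_nonpos (by linarith [hr.2])] at e1
  rw [hf0, hf1] at hd
  rw [hf0] at e0
  rw [hf1] at e1
  have t1 := dist_triangle x (f r) (ρ x y u)
  have t2 := dist_triangle (ρ x y u) (f r) y
  rw [dist_comm (f r)] at t1
  linarith

/-- let `X` be a geodesic metric space and suppose that for all
`x, y` a path `ρ x y : [0,1] → X` from `x` to `y` has been chosen such that
for some `n > 0`:
(1) if `d(x,y) ≤ 1` then the image of `ρ x y` has diameter at most `n`;
(2) for `0 ≤ s < t < 1` the Hausdorff distance between `ρ x y ([s,t])` and the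
    image of the chosen path from `ρ x y s` to `ρ x y t` is at most `n`;
(3) (thin triangles) for all `x, y, z` the image of `ρ x y` is contained in
    the `n`-neighborhood of the union of the images of `ρ y z` and `ρ z x`.
Then `X` is Gromov hyperbolic. -/
theorem hyperbolicity_criterion (X : Type*) [MetricSpace X]
    (hgeo : GeodesicSpace X)
    (ρ : X → X → ℝ → X) (n : ℝ) (hn : 0 < n)
    (hcont : ∀ x y, ContinuousOn (ρ x y) (Set.Icc 0 1))
    (hstart : ∀ x y, ρ x y 0 = x) (hend : ∀ x y, ρ x y 1 = y)
    (h1 : ∀ x y, dist x y ≤ 1 → diam (ρ x y '' Set.Icc (0:ℝ) 1) ≤ n)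
    (h2 : ∀ x y, ∀ s t : ℝ, 0 ≤ s → s < t → t < 1 →
      hausdorffDist (ρ x y '' Set.Icc s t)
        (ρ (ρ x y s) (ρ x y t) '' Set.Icc (0:ℝ) 1) ≤ n)
    (h3 : ∀ x y z, ∀ u ∈ Set.Icc (0:ℝ) 1, ∃ w ∈ Set.Icc (0:ℝ) 1,
      dist (ρ x y u) (ρ y z w) ≤ n ∨ dist (ρ x y u) (ρ z x w) ≤ n) :
    GromovHyperbolic X := by
  have hcomp : ∀ x y, IsCompact (ρ x y '' Set.Icc (0:ℝ) 1) := fun x y =>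
    isCompact_Icc.image_of_continuousOn (hcont x y)
  have m0 : (0:ℝ) ∈ Set.Icc (0:ℝ) 1 := ⟨le_rfl, zero_le_one⟩
  have m1 : (1:ℝ) ∈ Set.Icc (0:ℝ) 1 := ⟨zero_le_one, le_rfl⟩
  have h1' : ∀ x y, dist x y ≤ 1 → ∀ u ∈ Set.Icc (0:ℝ) 1, dist (ρ x y u) x ≤ n := by
    intro x y hxy u hu
    have h := dist_le_diam_of_mem (hcomp x y).isBounded
      (Set.mem_image_of_mem (ρ x y) hu) (Set.mem_image_of_mem (ρ x y) m0)
    rw [hstart] at h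
    exact h.trans (h1 x y hxy)
  obtain ⟨R, hR, hU⟩ := hc_unif hgeo ρ n hn hstart h1' h3
  -- a point of `ρ x y` close to both other sides
  have hcen : ∀ x y w, ∃ u ∈ Set.Icc (0:ℝ) 1, ∃ a ∈ Set.Icc (0:ℝ) 1, ∃ b ∈ Set.Icc (0:ℝ) 1,
      dist (ρ x y u) (ρ y w a) ≤ n ∧ dist (ρ x y u) (ρ w x b) ≤ n := by
    intro x y w
    let g : ℝ → ℝ := fun u => infDist (ρ x y u) (ρ w x '' Set.Icc (0:ℝ) 1)
      - infDist (ρ x y u) (ρ y w '' Set.Icc (0:ℝ) 1)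
    have hg : ContinuousOn g (Set.Icc 0 1) :=
      ((continuous_infDist_pt _).comp_continuousOn (hcont x y)).sub
        ((continuous_infDist_pt _).comp_continuousOn (hcont x y))
    have hg0 : g 0 ≤ 0 := by
      have : infDist (ρ x y 0) (ρ w x '' Set.Icc (0:ℝ) 1) = 0 :=
        infDist_zero_of_mem ⟨1, m1, by rw [hend, hstart]⟩
      have h' : 0 ≤ infDist (ρ x y 0) (ρ y w '' Set.Icc (0:ℝ) 1) := infDist_nonneg
      simp only [g]; linarith
    have hg1 : 0 ≤ g 1 := by
      have : infDist (ρ x y 1) (ρ y w '' Set.Icc (0:ℝ) 1) = 0 :=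
        infDist_zero_of_mem ⟨0, m0, by rw [hend, hstart]⟩
      have h' : 0 ≤ infDist (ρ x y 1) (ρ w x '' Set.Icc (0:ℝ) 1) := infDist_nonneg
      simp only [g]; linarith
    obtain ⟨u, hu, hgu⟩ := intermediate_value_Icc zero_le_one hg ⟨hg0, hg1⟩
    have heq : infDist (ρ x y u) (ρ w x '' Set.Icc (0:ℝ) 1)
      = infDist (ρ x y u) (ρ y w '' Set.Icc (0:ℝ) 1) := by
      simp only [g] at hgu; linarith
    obtain ⟨_, ⟨a, ha, rfl⟩, hda⟩ := (hcomp y w).exists_infDist_eq_dist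
      ⟨_, Set.mem_image_of_mem _ m0⟩ (ρ x y u)
    obtain ⟨_, ⟨b, hb, rfl⟩, hdb⟩ := (hcomp w x).exists_infDist_eq_dist
      ⟨_, Set.mem_image_of_mem _ m0⟩ (ρ x y u)
    refine ⟨u, hu, a, ha, b, hb, ?_⟩
    obtain ⟨v, hv, h⟩ := h3 x y w u hu
    rcases h with h | h
    · have := infDist_le_dist_of_mem (x := ρ x y u) (Set.mem_image_of_mem (ρ y w) hv)
      constructor <;> linarith
    · have := infDist_le_dist_of_mem (x := ρ x y u) (Set.mem_image_of_mem (ρ w x) hv)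
      constructor <;> linarith
  refine ⟨3 * n + 3 * R, by linarith, fun x y z w => ?_⟩
  obtain ⟨u, hu, a, ha, b, hb, hda, hdb⟩ := hcen x y w
  have ka := hU y w a ha
  have kb := hU w x b hb
  obtain ⟨v, hv, h⟩ := h3 x y z u hu
  set p := ρ x y u
  have a1 := dist_triangle y (ρ y w a) p
  have a2 := dist_triangle p (ρ y w a) w
  have b1 := dist_triangle w (ρ w x b) p
  have b2 := dist_triangle p (ρ w x b) x
  have c1 := dist_triangle x p y
  rw [dist_comm (ρ y w a) p] at a1
  rw [dist_comm (ρ w x b) p] at b1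
  rw [dist_comm x p, dist_comm p y] at c1
  rw [dist_comm w p] at b1
  rw [dist_comm w x] at kb
  rcases h with h | h
  · have kc := hU y z v hv
    have d1 := dist_triangle y (ρ y z v) w
    have d2 := dist_triangle z (ρ y z v) w
    have d3 := dist_triangle (ρ y z v) p w
    rw [dist_comm (ρ y z v) p] at d3
    rw [dist_comm z (ρ y z v)] at d2
    have := le_max_right (dist x z + dist y w) (dist x w + dist y z)
    linarith
  · have kc := hU z x v hv
    have d1 := dist_triangle x (ρ z x v) w
    have d2 := dist_triangle z (ρ z x v) w
    have d3 := dist_triangle (ρ z x v) p w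
    rw [dist_comm (ρ z x v) p] at d3
    rw [dist_comm x (ρ z x v)] at d1
    rw [dist_comm z x] at kc
    have := le_max_left (dist x z + dist y w) (dist x w + dist y z)
    linarith
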